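/- For any good sequence of (n,R_n) coordination codes for P_{Y|X}, the normalized mutual information converges to the per-letter mutual information: lim_{n→∞} (1/n) I(X^n;Y^n) = I(X;Y), where I(X^n;Y^n) is evaluated with respect to the code-induced joint distribution P_{X^nY^n} and I(X;Y) is evaluated with respect to P_{XY} = P_X P_{Y|X}. -/

import Mathlib

open scoped BigOperators ENNReal Classical
open Filter

section InformationDefs

variable {α X Y : Type*}

/-- A probability mass function on a finite alphabet. -/
def IsPMF [Fintype α] (P : α → ℝ) : Prop :=
  (∀ a, 0 ≤ P a) ∧ ∑ a, P a = 1

/-- Variational distance `‖P − Q‖ = sup_A |P(A) − Q(A)|` on a finite alphabet. -/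
noncomputable def tvDist [Fintype α] (P Q : α → ℝ) : ℝ :=
  Finset.univ.powerset.sup' ⟨∅, Finset.empty_mem_powerset _⟩
    fun A => |∑ a ∈ A, P a - ∑ a ∈ A, Q a|

/-- Relative entropy `D(P‖Q) = ∑ P log(P/Q)` on a finite alphabet, infinite when
`P` is not absolutely continuous with respect to `Q`. -/
noncomputable def relEnt [Fintype α] (P Q : α → ℝ) : ℝ≥0∞ :=
  if ∀ a, Q a = 0 → P a = 0 then
    ENNReal.ofReal (∑ a, P a * Real.log (P a / Q a))
  else ⊤

/-- Shannon entropy on a finite alphabet. -/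
noncomputable def entropy [Fintype α] (P : α → ℝ) : ℝ :=
  -∑ a, P a * Real.log (P a)

/-- First (X-) marginal of a joint distribution. -/
noncomputable def margX [Fintype Y] (P : X × Y → ℝ) : X → ℝ :=
  fun x => ∑ y, P (x, y)

/-- Second (Y-) marginal of a joint distribution. -/
noncomputable def margY [Fintype X] (P : X × Y → ℝ) : Y → ℝ :=
  fun y => ∑ x, P (x, y)

/-- Backward conditional distribution `P_{X|Y}(x|y) = P(x,y)/P_Y(y)`. -/
noncomputable def condXY [Fintype X] (P : X × Y → ℝ) : X → Y → ℝ :=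
  fun x y => P (x, y) / margY P y

/-- Forward conditional distribution `P_{Y|X}(y|x) = P(x,y)/P_X(x)`. -/
noncomputable def condYX [Fintype Y] (P : X × Y → ℝ) : Y → X → ℝ :=
  fun y x => P (x, y) / margX P x

/-- Mutual information `I(X;Y)` of a joint distribution on a finite product alphabet. -/
noncomputable def mutualInfo [Fintype X] [Fintype Y] (P : X × Y → ℝ) : ℝ :=
  ∑ x, ∑ y, P (x, y) * Real.log (P (x, y) / (margX P x * margY P y))

/-- A block code of length `n`: an encoder into `{1,…,M}` and a decoder. -/
structure Code (X Y : Type*) (n : ℕ) where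
  M : ℕ
  hM : 0 < M
  enc : (Fin n → X) → Fin M
  dec : Fin M → Fin n → Y

/-- Rate `R_n = (1/n) log M` of a code. -/
noncomputable def Code.rate {X Y : Type*} {n : ℕ} (c : Code X Y n) : ℝ :=
  Real.log c.M / n

/-- The reconstruction sequence `Yⁿ = g_n(f_n(xⁿ))` produced by a code. -/
def Code.out {X Y : Type*} {n : ℕ} (c : Code X Y n) (xs : Fin n → X) : Fin n → Y :=
  c.dec (c.enc xs)

/-- The i.i.d. (memoryless) source distribution on `n`-blocks. -/
noncomputable def iid (PX : X → ℝ) (n : ℕ) : (Fin n → X) → ℝ :=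
  fun xs => ∏ i, PX (xs i)

/-- The code-induced joint distribution
`P_{XⁿYⁿ}(xⁿ,yⁿ) = ∏ P_X(x_i) · 1{yⁿ = g_n(f_n(xⁿ))}`. -/
noncomputable def inducedJoint [DecidableEq Y] (PX : X → ℝ) {n : ℕ} (c : Code X Y n) :
    (Fin n → X) × (Fin n → Y) → ℝ :=
  fun p => (∏ i, PX (p.1 i)) * (if p.2 = c.out p.1 then 1 else 0)

/-- The approximating joint distribution
`Q_{XⁿYⁿ}(xⁿ,yⁿ) = (|g_n⁻¹(yⁿ)|/M) · ∏ P_{X|Y}(x_i|y_i)`: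
a uniformly chosen codeword passed through the backward memoryless channel. -/
noncomputable def approxJoint [Fintype X] [DecidableEq Y] (PXY : X × Y → ℝ) {n : ℕ}
    (c : Code X Y n) : (Fin n → X) × (Fin n → Y) → ℝ :=
  fun p => (((Finset.univ.filter fun m => c.dec m = p.2).card : ℝ) / c.M) *
    ∏ i, condXY PXY (p.1 i) (p.2 i)

/-- The uniform distribution over the codebook, `Q_{Yⁿ}(yⁿ) = |g_n⁻¹(yⁿ)|/M`. -/
noncomputable def codebookUniform [DecidableEq Y] {n : ℕ} (c : Code X Y n) :
    (Fin n → Y) → ℝ :=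
  fun ys => ((Finset.univ.filter fun m => c.dec m = ys).card : ℝ) / c.M

/-- The empirical (joint type) distribution of a pair of sequences. -/
noncomputable def empDist [DecidableEq X] [DecidableEq Y] {n : ℕ}
    (xs : Fin n → X) (ys : Fin n → Y) : X × Y → ℝ :=
  fun p => ((Finset.univ.filter fun i => xs i = p.1 ∧ ys i = p.2).card : ℝ) / n

/-- `‖T_{XⁿYⁿ} − P_{XY}‖ → 0` in probability under the i.i.d. source. -/
def TVInProb [Fintype X] [Fintype Y] [DecidableEq X] [DecidableEq Y]
    (PX : X → ℝ) (PXY : X × Y → ℝ) (c : ∀ n, Code X Y n) : Prop :=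
  ∀ ε : ℝ, 0 < ε →
    Tendsto (fun n => ∑ xs : Fin n → X,
        if ε < tvDist (empDist xs ((c n).out xs)) PXY then iid PX n xs else 0)
      atTop (nhds 0)

/-- A good sequence of coordination codes for `P_{Y|X}` (specified via the joint `PXY`):
the rates converge to `I(X;Y)` and the empirical distribution converges to `PXY`
in variational distance, in probability. -/
def GoodCoord [Fintype X] [Fintype Y] [DecidableEq X] [DecidableEq Y]
    (PX : X → ℝ) (PXY : X × Y → ℝ) (c : ∀ n, Code X Y n) : Prop :=
  Tendsto (fun n => (c n).rate) atTop (nhds (mutualInfo PXY)) ∧ TVInProb PX PXY c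

end InformationDefs

section MutualInfoBounds

variable {A B : Type*}

lemma apply_le_margX [Fintype B] {P : A × B → ℝ} (h0 : ∀ p, 0 ≤ P p) (a : A) (b : B) :
    P (a, b) ≤ margX P a :=
  Finset.single_le_sum (f := fun b => P (a, b)) (fun b _ => h0 (a, b)) (Finset.mem_univ b)

lemma apply_le_margY [Fintype A] {P : A × B → ℝ} (h0 : ∀ p, 0 ≤ P p) (a : A) (b : B) :
    P (a, b) ≤ margY P b :=
  Finset.single_le_sum (f := fun a => P (a, b)) (fun a _ => h0 (a, b)) (Finset.mem_univ a)

lemma margX_nonneg [Fintype B] {P : A × B → ℝ} (h0 : ∀ p, 0 ≤ P p) (a : A) : 0 ≤ margX P a :=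
  Finset.sum_nonneg fun _ _ => h0 _

lemma margY_nonneg [Fintype A] {P : A × B → ℝ} (h0 : ∀ p, 0 ≤ P p) (b : B) : 0 ≤ margY P b :=
  Finset.sum_nonneg fun _ _ => h0 _

variable [Fintype A] [Fintype B]

lemma sum_margY (P : A × B → ℝ) : ∑ b, margY P b = ∑ a, ∑ b, P (a, b) :=
  Finset.sum_comm

/-- Variational lower bound on mutual information: a test function whose exponential has
`P_X`-mean at most one for every `b` has expectation at most the mutual information. -/
lemma sum_mul_le_mutualInfo {P : A × B → ℝ} (h0 : ∀ p, 0 ≤ P p)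
    (h1 : ∑ a, ∑ b, P (a, b) = 1) {F : A → B → ℝ}
    (hF : ∀ b, ∑ a, margX P a * Real.exp (F a b) ≤ 1) :
    ∑ a, ∑ b, P (a, b) * F a b ≤ mutualInfo P := by
  have key : ∀ a b, P (a, b) * F a b + P (a, b) - margY P b * (margX P a * Real.exp (F a b))
      ≤ P (a, b) * Real.log (P (a, b) / (margX P a * margY P b)) := by
    intro a b
    have hx := margX_nonneg h0 a
    have hy := margY_nonneg h0 b
    rcases (h0 (a, b)).eq_or_lt with h | h
    · rw [← h]
      have : 0 ≤ margY P b * (margX P a * Real.exp (F a b)) := by positivity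
      simp only [zero_mul]
      linarith
    · have hx' := h.trans_le (apply_le_margX h0 a b)
      have hy' := h.trans_le (apply_le_margY h0 a b)
      have hlog := Real.one_sub_inv_le_log_of_pos
        (x := P (a, b) / (margX P a * margY P b) / Real.exp (F a b)) (by positivity)
      rw [Real.log_div (by positivity) (by positivity), Real.log_exp] at hlog
      have := mul_le_mul_of_nonneg_left hlog h.le
      have e : P (a, b) * (1 - (P (a, b) / (margX P a * margY P b) / Real.exp (F a b))⁻¹)
          = P (a, b) - margY P b * (margX P a * Real.exp (F a b)) := by
        field_simp
      rw [e] at this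
      linarith
  have hsum : ∑ a, ∑ b, margY P b * (margX P a * Real.exp (F a b)) ≤ 1 := by
    rw [Finset.sum_comm]
    calc _ ≤ ∑ b, margY P b := Finset.sum_le_sum fun b _ => by
          rw [← Finset.mul_sum]
          exact mul_le_of_le_one_right (margY_nonneg h0 b) (hF b)
      _ = 1 := by rw [sum_margY, h1]
  have := Finset.sum_le_sum fun a (_ : a ∈ Finset.univ) =>
    Finset.sum_le_sum fun b (_ : b ∈ Finset.univ) => key a b
  simp only [Finset.sum_sub_distrib, Finset.sum_add_distrib] at this
  unfold mutualInfo
  linarith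

/-- Mutual information is at most the logarithm of the size of a set supporting the second
marginal. -/
lemma mutualInfo_le_log {P : A × B → ℝ} (h0 : ∀ p, 0 ≤ P p)
    (h1 : ∑ a, ∑ b, P (a, b) = 1) {S : Finset B} {M : ℕ} (hM : 0 < M) (hS : S.card ≤ M)
    (hP : ∀ b ∉ S, margY P b = 0) : mutualInfo P ≤ Real.log M := by
  have hM' : (0 : ℝ) < M := by exact_mod_cast hM
  have key : ∀ a b, P (a, b) * Real.log (P (a, b) / (margX P a * margY P b))
      ≤ P (a, b) * Real.log M + (P (a, b) / (M * margY P b) - P (a, b)) := by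
    intro a b
    rcases (h0 (a, b)).eq_or_lt with h | h
    · simp [← h]
    · have hX := apply_le_margX h0 a b
      have hx' := h.trans_le hX
      have hy' := h.trans_le (apply_le_margY h0 a b)
      have hle : P (a, b) / (margX P a * margY P b) ≤ M * (1 / (M * margY P b)) := by
        rw [div_le_iff₀ (by positivity)]
        have : (M : ℝ) * (1 / (M * margY P b)) * (margX P a * margY P b) = margX P a := by
          field_simp
        rwa [this]
      have hlog := Real.log_le_log (by positivity) hle
      rw [Real.log_mul (by positivity) (by positivity)] at hlog
      have h2 := Real.log_le_sub_one_of_pos (x := 1 / (M * margY P b)) (by positivity)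
      have := mul_le_mul_of_nonneg_left (hlog.trans (add_le_add_right h2 _)) h.le
      calc _ ≤ _ := this
        _ = _ := by ring
  have hsum : ∑ a, ∑ b, P (a, b) / (M * margY P b) ≤ 1 := by
    rw [Finset.sum_comm]
    calc _ = ∑ b, margY P b / (M * margY P b) := by simp only [← Finset.sum_div]; rfl
      _ = ∑ b ∈ S, margY P b / (M * margY P b) :=
          (Finset.sum_subset (Finset.subset_univ S) fun b _ hb => by simp [hP b hb]).symm
      _ ≤ ∑ _b ∈ S, (1 : ℝ) / M := Finset.sum_le_sum fun b _ => by
          rw [mul_comm, ← div_div]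
          exact div_le_div_of_nonneg_right (div_self_le_one _) hM'.le
      _ ≤ 1 := by
          rw [Finset.sum_const, nsmul_eq_mul, mul_one_div, div_le_one hM']
          exact_mod_cast hS
  have := Finset.sum_le_sum fun a (_ : a ∈ Finset.univ) =>
    Finset.sum_le_sum fun b (_ : b ∈ Finset.univ) => key a b
  simp only [Finset.sum_sub_distrib, Finset.sum_add_distrib, ← Finset.sum_mul, h1] at this
  unfold mutualInfo
  linarith

end MutualInfoBounds

section CoordinationCodes

variable {α X Y : Type*}

lemma abs_sub_le_tvDist [Fintype α] (P Q : α → ℝ) (a : α) : |P a - Q a| ≤ tvDist P Q := by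
  have := Finset.le_sup' (fun A : Finset α => |∑ a ∈ A, P a - ∑ a ∈ A, Q a|)
    (Finset.mem_powerset.2 (Finset.subset_univ {a}))
  simpa [tvDist] using this

lemma iid_nonneg {PX : X → ℝ} (h : ∀ x, 0 ≤ PX x) (n : ℕ) (xs : Fin n → X) :
    0 ≤ iid PX n xs :=
  Finset.prod_nonneg fun _ _ => h _

lemma sum_prod_apply [Fintype X] {n : ℕ} (g : Fin n → X → ℝ) :
    ∑ xs : Fin n → X, ∏ i, g i (xs i) = ∏ i, ∑ x, g i x := by
  rw [Finset.prod_univ_sum, Fintype.piFinset_univ]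

lemma sum_iid [Fintype X] {PX : X → ℝ} (h : IsPMF PX) (n : ℕ) : ∑ xs, iid PX n xs = 1 := by
  unfold iid
  rw [sum_prod_apply fun _ => PX]
  simp [h.2]

lemma empDist_nonneg [DecidableEq X] [DecidableEq Y] {n : ℕ} (xs : Fin n → X)
    (ys : Fin n → Y) (p : X × Y) : 0 ≤ empDist xs ys p := by
  unfold empDist; positivity

lemma empDist_le_one [DecidableEq X] [DecidableEq Y] {n : ℕ} (xs : Fin n → X)
    (ys : Fin n → Y) (p : X × Y) : empDist xs ys p ≤ 1 := by
  unfold empDist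
  refine div_le_one_of_le₀ ?_ (by positivity)
  exact_mod_cast (Finset.card_le_univ _).trans_eq (Fintype.card_fin n)

lemma sum_apply_eq_empDist [Fintype X] [Fintype Y] [DecidableEq X] [DecidableEq Y] {n : ℕ}
    (hn : n ≠ 0) (xs : Fin n → X) (ys : Fin n → Y) (f : X × Y → ℝ) :
    ∑ i, f (xs i, ys i) = n * ∑ p, empDist xs ys p * f p := by
  have hn' : (n : ℝ) ≠ 0 := by exact_mod_cast hn
  rw [Finset.mul_sum, ← Finset.sum_fiberwise Finset.univ (fun i => (xs i, ys i))]
  refine Finset.sum_congr rfl fun p _ => ?_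
  rw [Finset.sum_congr rfl (g := fun _ => f p)
    fun i hi => congrArg f (Finset.mem_filter.1 hi).2, Finset.sum_const, nsmul_eq_mul, empDist]
  simp only [Prod.ext_iff]
  field_simp

section Induced

variable [DecidableEq Y] {PX : X → ℝ} {n : ℕ} (c : Code X Y n)

lemma inducedJoint_nonneg [Fintype X] (h : IsPMF PX) (p : (Fin n → X) × (Fin n → Y)) :
    0 ≤ inducedJoint PX c p := by
  unfold inducedJoint
  have := iid_nonneg h.1 n p.1
  unfold iid at this
  split_ifs <;> simp [this]

lemma sum_inducedJoint_mul [Fintype Y] (xs : Fin n → X) (F : (Fin n → Y) → ℝ) :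
    ∑ ys, inducedJoint PX c (xs, ys) * F ys = iid PX n xs * F (c.out xs) := by
  simp [inducedJoint, iid]

lemma margX_inducedJoint [Fintype Y] (xs : Fin n → X) :
    margX (inducedJoint PX c) xs = iid PX n xs := by
  simpa [margX] using sum_inducedJoint_mul (PX := PX) c xs fun _ => 1

variable [Fintype X] [Fintype Y]

lemma sum_inducedJoint (h : IsPMF PX) : ∑ xs, ∑ ys, inducedJoint PX c (xs, ys) = 1 :=
  (Finset.sum_congr rfl fun xs _ => margX_inducedJoint c xs).trans (sum_iid h n)

lemma mutualInfo_inducedJoint_le (h : IsPMF PX) :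
    mutualInfo (inducedJoint PX c) ≤ Real.log c.M := by
  refine mutualInfo_le_log (inducedJoint_nonneg c h) (sum_inducedJoint c h)
    (S := Finset.univ.image c.dec) c.hM
    (Finset.card_image_le.trans_eq (by simp)) fun ys hys => ?_
  refine Finset.sum_eq_zero fun xs _ => ?_
  have : ys ≠ c.out xs := fun e =>
    hys (Finset.mem_image.2 ⟨c.enc xs, Finset.mem_univ _, e.symm⟩)
  simp [inducedJoint, this]

/-- Single-letter variational lower bound on the block mutual information of a code. -/
lemma sum_iid_mul_le_mutualInfo (h : IsPMF PX) {f : X × Y → ℝ}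
    (hf : ∀ y, ∑ x, PX x * Real.exp (f (x, y)) ≤ 1) :
    ∑ xs, iid PX n xs * ∑ i, f (xs i, c.out xs i) ≤ mutualInfo (inducedJoint PX c) := by
  have := sum_mul_le_mutualInfo (inducedJoint_nonneg c h) (sum_inducedJoint c h)
    (F := fun xs ys => ∑ i, f (xs i, ys i)) fun ys => by
      simp only [margX_inducedJoint, iid, Real.exp_sum, ← Finset.prod_mul_distrib]
      rw [sum_prod_apply fun i x => PX x * Real.exp (f (x, ys i))]
      exact Finset.prod_le_one
        (fun i _ => Finset.sum_nonneg fun x _ => mul_nonneg (h.1 x) (Real.exp_pos _).le)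
        fun i _ => hf _
  simpa only [sum_inducedJoint_mul] using this

/-- If a single-letter test function is admissible, the normalized block mutual information is
bounded below by its `P_{XY}`-mean, up to the deviation of the joint type. -/
lemma le_mutualInfo_inducedJoint_div [DecidableEq X] (h : IsPMF PX) {PXY : X × Y → ℝ}
    (hP : IsPMF PXY) (hn : n ≠ 0) {f : X × Y → ℝ}
    (hf : ∀ y, ∑ x, PX x * Real.exp (f (x, y)) ≤ 1) {ε : ℝ} (hε : 0 ≤ ε) :
    ∑ p, PXY p * f p - (∑ p, |f p|) * (ε + ∑ xs : Fin n → X,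
        if ε < tvDist (empDist xs (c.out xs)) PXY then iid PX n xs else 0)
      ≤ mutualInfo (inducedJoint PX c) / n := by
  have hn' : (0 : ℝ) < n := by exact_mod_cast Nat.pos_of_ne_zero hn
  have hC : 0 ≤ ∑ p, |f p| := Finset.sum_nonneg fun _ _ => abs_nonneg _
  have hdev : ∀ xs : Fin n → X, ∀ t, (∀ p, |empDist xs (c.out xs) p - PXY p| ≤ t) →
      ∑ p, PXY p * f p - (∑ p, |f p|) * t ≤ ∑ p, empDist xs (c.out xs) p * f p := by
    intro xs t ht
    rw [Finset.sum_mul, ← Finset.sum_sub_distrib]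
    refine Finset.sum_le_sum fun p _ => ?_
    have h1 := neg_abs_le ((empDist xs (c.out xs) p - PXY p) * f p)
    rw [abs_mul] at h1
    have h2 := mul_le_mul_of_nonneg_right (ht p) (abs_nonneg (f p))
    linarith
  have hpt : ∀ xs : Fin n → X,
      iid PX n xs * (∑ p, PXY p * f p - (∑ p, |f p|) * ε) - (∑ p, |f p|) *
        (if ε < tvDist (empDist xs (c.out xs)) PXY then iid PX n xs else 0)
      ≤ iid PX n xs * ∑ p, empDist xs (c.out xs) p * f p := by
    intro xs
    have hi := iid_nonneg h.1 n xs
    split_ifs with hlt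
    · have := hdev xs 1 fun p => by
        have h1 := empDist_nonneg xs (c.out xs) p
        have h2 := empDist_le_one xs (c.out xs) p
        have h3 := hP.1 p
        have h4 : PXY p ≤ 1 := hP.2 ▸
          Finset.single_le_sum (fun q _ => hP.1 q) (Finset.mem_univ p)
        rw [abs_le]; constructor <;> linarith
      have := mul_le_mul_of_nonneg_left this hi
      have := mul_nonneg hi (mul_nonneg hC hε)
      linarith
    · have := hdev xs ε fun p => (abs_sub_le_tvDist _ _ p).trans (not_lt.1 hlt)
      have := mul_le_mul_of_nonneg_left this hi
      linarith
  have hsum := Finset.sum_le_sum fun xs (_ : xs ∈ Finset.univ) => hpt xs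
  rw [Finset.sum_sub_distrib, ← Finset.sum_mul, sum_iid h, ← Finset.mul_sum] at hsum
  have hI := sum_iid_mul_le_mutualInfo c h hf
  simp only [sum_apply_eq_empDist hn, mul_left_comm _ (n : ℝ), ← Finset.mul_sum] at hI
  rw [le_div_iff₀ hn', mul_comm]
  refine le_trans (mul_le_mul_of_nonneg_left ?_ hn'.le) hI
  linarith

end Induced

/-- The log-likelihood ratio of `P` against its product of marginals, smoothed by `δ` so that it
is finite everywhere. -/
noncomputable def smoothedLLR [Fintype X] [Fintype Y] (P : X × Y → ℝ) (δ : ℝ) : X × Y → ℝ :=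
  fun p => Real.log ((1 - δ) * (P p / (margX P p.1 * margY P p.2)) + δ)

section SmoothedLLR

variable [Fintype X] [Fintype Y] {P : X × Y → ℝ} {δ : ℝ}

lemma sum_margX_mul_exp_smoothedLLR_le_one (hP : IsPMF P) (h0 : 0 < δ) (h1 : δ ≤ 1) (y : Y) :
    ∑ x, margX P x * Real.exp (smoothedLLR P δ (x, y)) ≤ 1 := by
  have hterm : ∀ x, margX P x * Real.exp (smoothedLLR P δ (x, y))
      ≤ (1 - δ) * (P (x, y) / margY P y) + margX P x * δ := by
    intro x
    have hx := margX_nonneg hP.1 x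
    have hy := margY_nonneg hP.1 y
    have hp := hP.1 (x, y)
    have hd : 0 ≤ 1 - δ := by linarith
    rw [smoothedLLR, Real.exp_log (by positivity)]
    rcases hx.eq_or_lt with h | h
    · rw [← h]; simp only [zero_mul, add_zero]; positivity
    · apply le_of_eq
      have : margX P x * ((1 - δ) * (P (x, y) / (margX P x * margY P y)) + δ)
          = (1 - δ) * ((margX P x / margX P x) * (P (x, y) / margY P y)) + margX P x * δ := by
        rw [div_mul_div_comm]; ring
      rw [this, div_self h.ne', one_mul]
  refine (Finset.sum_le_sum fun x _ => hterm x).trans ?_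
  rw [Finset.sum_add_distrib, ← Finset.mul_sum, ← Finset.sum_mul, ← Finset.sum_div]
  have e1 : ∑ x, margX P x = 1 := by rw [← hP.2, Fintype.sum_prod_type]; rfl
  have e2 : (∑ x, P (x, y)) / margY P y ≤ 1 := div_self_le_one _
  have := mul_le_mul_of_nonneg_left e2 (sub_nonneg.2 h1)
  rw [e1]
  linarith

lemma mutualInfo_add_log_le_sum_smoothedLLR (hP : IsPMF P) (h0 : 0 ≤ δ) (h1 : δ < 1) :
    mutualInfo P + Real.log (1 - δ) ≤ ∑ p, P p * smoothedLLR P δ p := by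
  have hlog : Real.log (1 - δ) = ∑ x, ∑ y, P (x, y) * Real.log (1 - δ) := by
    rw [← Fintype.sum_prod_type' fun x y => P (x, y) * Real.log (1 - δ), ← Finset.sum_mul, hP.2,
      one_mul]
  rw [hlog, mutualInfo, ← Finset.sum_add_distrib, Fintype.sum_prod_type]
  simp only [← Finset.sum_add_distrib]
  refine Finset.sum_le_sum fun x _ => Finset.sum_le_sum fun y _ => ?_
  rcases (hP.1 (x, y)).eq_or_lt with h | h
  · simp [← h]
  · have hx := h.trans_le (apply_le_margX hP.1 x y)
    have hy := h.trans_le (apply_le_margY hP.1 x y)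
    have hd : 0 < 1 - δ := by linarith
    rw [← mul_add, add_comm, ← Real.log_mul (by positivity) (by positivity)]
    exact mul_le_mul_of_nonneg_left
      (Real.log_le_log (by positivity) (le_add_of_nonneg_right h0)) h.le

end SmoothedLLR

end CoordinationCodes

/-- For any good sequence of coordination codes for `P_{Y|X}`, the normalized mutual
information under the code-induced joint distribution converges to the per-letter
mutual information: `(1/n) I(Xⁿ;Yⁿ) → I(X;Y)`. -/
theorem good_coordination_codes_normalized_mutualInfo
    {X Y : Type*} [Fintype X] [Fintype Y] [DecidableEq X] [DecidableEq Y]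
    (PX : X → ℝ) (hPX : IsPMF PX) (hPXfull : ∀ x, 0 < PX x)
    (W : X → Y → ℝ) (hW : ∀ x, IsPMF (W x))
    (PXY : X × Y → ℝ) (hPXY : ∀ x y, PXY (x, y) = PX x * W x y)
    (c : ∀ n, Code X Y n) (hgood : GoodCoord PX PXY c) :
    Tendsto (fun n => mutualInfo (inducedJoint PX (c n)) / (n : ℝ))
      atTop (nhds (mutualInfo PXY)) := by
  have hP : IsPMF PXY := by
    refine ⟨fun p => ?_, ?_⟩
    · rw [← Prod.mk.eta (p := p), hPXY]
      exact mul_nonneg (hPX.1 _) ((hW _).1 _)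
    · simp only [Fintype.sum_prod_type, hPXY, ← Finset.mul_sum, (hW _).2, mul_one, hPX.2]
  have hmarg : margX PXY = PX := by
    funext x
    simp only [margX, hPXY, ← Finset.mul_sum, (hW x).2, mul_one]
  refine tendsto_order.2 ⟨fun a ha => ?_, fun b hb => ?_⟩
  · set g := mutualInfo PXY - a
    have hg : 0 < g := sub_pos.2 ha
    set δ := 1 - Real.exp (-(g / 4))
    have hδ0 : 0 < δ := sub_pos.2 (Real.exp_lt_one_iff.2 (by linarith))
    have hδ1 : δ < 1 := sub_lt_self _ (Real.exp_pos _)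
    set C := ∑ p, |smoothedLLR PXY δ p|
    have hC : 0 ≤ C := Finset.sum_nonneg fun _ _ => abs_nonneg _
    set ε := g / (4 * (C + 1))
    have hε : 0 < ε := by positivity
    have hCε : C * ε ≤ g / 4 := by
      have : (C + 1) * ε = g / 4 := by simp only [ε]; field_simp
      linarith
    filter_upwards [(hgood.2 ε hε).eventually_lt_const hε, eventually_ne_atTop 0] with n hn hn0
    have hlow := le_mutualInfo_inducedJoint_div (c n) hPX hP hn0
      (hmarg ▸ sum_margX_mul_exp_smoothedLLR_le_one hP hδ0 hδ1.le) hε.le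
    refine lt_of_lt_of_le ?_ hlow
    have hJ := mutualInfo_add_log_le_sum_smoothedLLR hP hδ0.le hδ1
    have hlog : Real.log (1 - δ) = -(g / 4) := by simp [δ]
    have := mul_le_mul_of_nonneg_left hn.le hC
    rw [hlog] at hJ
    rw [mul_add]
    have : g = mutualInfo PXY - a := rfl
    linarith
  · filter_upwards [hgood.1.eventually_lt_const hb] with n hn
    exact lt_of_le_of_lt
      (div_le_div_of_nonneg_right (mutualInfo_inducedJoint_le (c n) hPX) n.cast_nonneg) hn
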